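/- Let p_1,…,p_N be constants with 2N/(N+2) < p_i for all i, p_h < N and p^∨ < p_h*, let s be a constant with 2 < s < p_h*, and set θ = (1/2 − 1/s)/((N+2)/(2N) − 1/p_h). Then for every M₀ > 0 there exist constants C and C', depending only on N, a, p_1,…,p_N, s and M₀, such that for every continuously differentiable function u on the closure of K_a with ‖u‖_{2,K_a} ≤ M₀: ‖u‖_{s,K_a} ≤ C Σ_{i=1}^N ‖D_i u‖_{p_i,K_a}^θ + C'. -/

import Mathlib

noncomputable section
open MeasureTheory Real Filter

/-- The open parallelepiped `K_a = {x : |x_i| < a_i}`. -/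
def Ka {N : ℕ} (a : Fin N → ℝ) : Set (Fin N → ℝ) := {x | ∀ i, |x i| < a i}

/-- The `i`-th partial derivative `D_i`. -/
def Dop {N : ℕ} (i : Fin N) (f : (Fin N → ℝ) → ℝ) : (Fin N → ℝ) → ℝ :=
  fun x => fderiv ℝ f x (Pi.single i 1)

/-- The `L^q(Ω)` norm. -/
def Lnorm {N : ℕ} (q : ℝ) (Ω : Set (Fin N → ℝ)) (v : (Fin N → ℝ) → ℝ) : ℝ :=
  (∫ x in Ω, |v x| ^ q) ^ (1 / q)

lemma oneD (a r : ℝ) (ha : 0 < a) (hr : 1 < r) (g g' : ℝ → ℝ)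
    (hg : ∀ t ∈ Set.Ioo (-a) a, HasDerivAt g (g' t) t)
    (hg' : ContinuousOn g' (Set.Ioo (-a) a)) (t0 : ℝ) (ht0 : t0 ∈ Set.Ioo (-a) a) :
    ENNReal.ofReal (|g t0| ^ r) ≤ ∫⁻ t in Set.Ioo (-a) a,
      ENNReal.ofReal (|g t| ^ r / (2 * a) + r * |g t| ^ (r - 1) * |g' t|) := by
  have hgc : ContinuousOn g (Set.Ioo (-a) a) := fun t ht => (hg t ht).continuousAt.continuousWithinAt
  have hφ : ∀ t ∈ Set.Ioo (-a) a, HasDerivAt (fun t => |g t| ^ r)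
      (r * |g t| ^ (r - 2) * g t * g' t) t := fun t ht =>
    (hasDerivAt_abs_rpow (g t) hr).comp t (hg t ht)
  have habs : ∀ t, |r * |g t| ^ (r - 2) * g t * g' t| = r * |g t| ^ (r - 1) * |g' t| := by
    intro t
    rw [abs_mul, abs_mul, abs_mul, abs_of_pos (by linarith : 0 < r), abs_of_nonneg (by positivity : 0 ≤ |g t| ^ (r-2))]
    by_cases h : g t = 0
    · simp [h, Real.zero_rpow (by linarith : r - 1 ≠ 0)]
    · rw [mul_assoc r, ← Real.rpow_add_one (by simpa using h)]
      ring_nf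
  set ψ : ℝ → ℝ := fun t => r * |g t| ^ (r - 1) * |g' t| with hψ
  have hψc : ContinuousOn ψ (Set.Ioo (-a) a) := by
    refine (continuousOn_const.mul (hgc.abs.rpow_const ?_)).mul hg'.abs
    intro x hx; right; linarith
  have hψ0 : ∀ t, 0 ≤ ψ t := fun t => by positivity
  set I := ∫⁻ t in Set.Ioo (-a) a, ENNReal.ofReal (ψ t) with hI
  have hsub : ∀ t1 ∈ Set.Ioo (-a) a, Set.uIcc t1 t0 ⊆ Set.Ioo (-a) a := by
    intro t1 h1
    exact (Set.ordConnected_Ioo).uIcc_subset h1 ht0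
  have hmeasψ : AEMeasurable (fun t => ENNReal.ofReal (ψ t)) (volume.restrict (Set.Ioo (-a) a)) :=
    (hψc.aemeasurable measurableSet_Ioo).ennreal_ofReal
  have key : ∀ t1 ∈ Set.Ioo (-a) a, ENNReal.ofReal (|g t0| ^ r) ≤ ENNReal.ofReal (|g t1| ^ r) + I := by
    intro t1 h1
    have hii : IntervalIntegrable ψ volume t1 t0 := (hψc.mono (hsub t1 h1)).intervalIntegrable
    have hle : |g t0| ^ r - |g t1| ^ r ≤ ∫ t in Set.uIoc t1 t0, ψ t := by
      by_cases hfin : IntervalIntegrable (fun t => r * |g t| ^ (r - 2) * g t * g' t) volume t1 t0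
      · have h := intervalIntegral.integral_eq_sub_of_hasDerivAt
          (fun t ht => hφ t (hsub t1 h1 ht)) hfin
        rw [← h]
        refine (le_abs_self _).trans ?_
        have := intervalIntegral.norm_integral_le_integral_norm_uIoc
          (f := fun t => r * |g t| ^ (r - 2) * g t * g' t) (a := t1) (b := t0) (μ := volume)
        simpa only [Real.norm_eq_abs, habs] using this
      · exfalso
        apply hfin
        refine IntervalIntegrable.mono_fun hii ?_ ?_
        · have hm : AEMeasurable (fun t => r * |g t| ^ (r - 2) * g t * g' t)
              (volume.restrict (Set.uIoc t1 t0)) := by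
            have hgm := (hgc.mono (Set.uIoc_subset_uIcc.trans (hsub t1 h1))).aemeasurable (μ := volume) measurableSet_uIoc
            have hgm' := (hg'.mono (Set.uIoc_subset_uIcc.trans (hsub t1 h1))).aemeasurable (μ := volume) measurableSet_uIoc
            have := hgm.abs
            exact (((this.pow_const (r-2)).const_mul r).mul hgm).mul hgm'
          exact hm.aestronglyMeasurable
        · refine Eventually.of_forall fun t => ?_
          simp only [Real.norm_eq_abs, habs]
          rw [abs_of_nonneg (hψ0 t)]
    have h2 : ENNReal.ofReal (∫ t in Set.uIoc t1 t0, ψ t) ≤ I := by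
      rw [ofReal_integral_eq_lintegral_ofReal (intervalIntegrable_iff.1 hii) (Eventually.of_forall hψ0)]
      exact lintegral_mono_set (Set.uIoc_subset_uIcc.trans (hsub t1 h1))
    calc ENNReal.ofReal (|g t0| ^ r) ≤ ENNReal.ofReal (|g t1| ^ r + ∫ t in Set.uIoc t1 t0, ψ t) :=
          ENNReal.ofReal_le_ofReal (by linarith)
      _ ≤ _ := ENNReal.ofReal_add_le.trans (by gcongr)
  have hc : (0:ℝ) < 1 / (2 * a) := by positivity
  have hone : ∫⁻ t in Set.Ioo (-a) a, ENNReal.ofReal (1 / (2 * a)) = 1 := by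
    rw [setLIntegral_const, Real.volume_Ioo, ← ENNReal.ofReal_mul hc.le]
    rw [show 1 / (2 * a) * (a - -a) = 1 by field_simp; ring]; simp
  calc ENNReal.ofReal (|g t0| ^ r)
      = ∫⁻ t in Set.Ioo (-a) a, ENNReal.ofReal (1 / (2 * a)) * ENNReal.ofReal (|g t0| ^ r) := by
        rw [lintegral_mul_const' _ _ ENNReal.ofReal_ne_top, hone, one_mul]
    _ ≤ ∫⁻ t in Set.Ioo (-a) a, (ENNReal.ofReal (1 / (2 * a)) * ENNReal.ofReal (|g t| ^ r)
          + ENNReal.ofReal (1 / (2 * a)) * I) := by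
        refine setLIntegral_mono' measurableSet_Ioo fun t ht => ?_
        rw [← mul_add]
        gcongr
        exact key t ht
    _ = (∫⁻ t in Set.Ioo (-a) a, ENNReal.ofReal (1 / (2 * a)) * ENNReal.ofReal (|g t| ^ r)) + I := by
        rw [lintegral_add_right _ measurable_const]
        congr 1
        rw [setLIntegral_const, mul_right_comm, ← setLIntegral_const, hone, one_mul]
    _ = ∫⁻ t in Set.Ioo (-a) a, (ENNReal.ofReal (1 / (2 * a)) * ENNReal.ofReal (|g t| ^ r) + ENNReal.ofReal (ψ t)) := by
        rw [lintegral_add_right' _ hmeasψ]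
    _ = _ := by
        refine lintegral_congr fun t => ?_
        rw [← ENNReal.ofReal_mul hc.le, ← ENNReal.ofReal_add (by positivity) (hψ0 t)]
        congr 1
        simp only [hψ]; ring

lemma Ka_eq {N : ℕ} (a : Fin N → ℝ) : Ka a = Set.pi Set.univ (fun i => Set.Ioo (-a i) (a i)) := by
  ext x; simp [Ka, abs_lt]

lemma Ka_isOpen {N : ℕ} (a : Fin N → ℝ) : IsOpen (Ka a) := by
  rw [Ka_eq]; exact isOpen_set_pi Set.finite_univ fun i _ => isOpen_Ioo

lemma Dop_continuousOn {N : ℕ} (a : Fin N → ℝ) (w : (Fin N → ℝ) → ℝ)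
    (hw : ContDiffOn ℝ 1 w (Ka a)) (i : Fin N) : ContinuousOn (Dop i w) (Ka a) :=
  (hw.continuousOn_fderiv_of_isOpen (Ka_isOpen a) le_rfl).clm_apply continuousOn_const

/-- Integrand of the grid-lines estimate. -/
def Fint {N : ℕ} (a : Fin N → ℝ) (r : Fin N → ℝ) (w : (Fin N → ℝ) → ℝ) (i : Fin N)
    (x : Fin N → ℝ) : ℝ :=
  |w x| ^ r i / (2 * a i) + r i * |w x| ^ (r i - 1) * |Dop i w x|

lemma Fint_continuousOn {N : ℕ} (a : Fin N → ℝ) (r : Fin N → ℝ) (hr : ∀ i, 1 < r i)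
    (w : (Fin N → ℝ) → ℝ) (hw : ContDiffOn ℝ 1 w (Ka a)) (i : Fin N) :
    ContinuousOn (Fint a r w i) (Ka a) := by
  have h := hw.continuousOn
  have h1 := hr i
  refine ((h.abs.rpow_const ?_).div_const _).add
    ((continuousOn_const.mul (h.abs.rpow_const ?_)).mul (Dop_continuousOn a w hw i).abs)
  · intro x _; right; linarith
  · intro x _; right; linarith

lemma gridlines (N : ℕ) (hN : 2 ≤ N) (a : Fin N → ℝ) (ha : ∀ i, 0 < a i)
    (r : Fin N → ℝ) (hr : ∀ i, 1 < r i) (q : ℝ) (hq : ∑ i, r i = (N - 1) * q)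
    (w : (Fin N → ℝ) → ℝ) (hw : ContDiffOn ℝ 1 w (Ka a)) :
    ∫⁻ x in Ka a, ENNReal.ofReal (|w x| ^ q) ≤
      (∫⁻ x in Ka a, ∑ i, ENNReal.ofReal (Fint a r w i x)) ^ ((N : ℝ) / (N - 1)) := by
  classical
  have hN' : (2:ℝ) ≤ N := by exact_mod_cast hN
  have hKm := (Ka_isOpen a).measurableSet
  set f : (Fin N → ℝ) → ENNReal := (Ka a).indicator (fun x => ∑ i, ENNReal.ofReal (Fint a r w i x)) with hf
  have hfm : Measurable f := by
    have : ContinuousOn (fun x => ∑ i, ENNReal.ofReal (Fint a r w i x)) (Ka a) :=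
      continuousOn_finsetSum _ fun i _ =>
        ENNReal.continuous_ofReal.comp_continuousOn (Fint_continuousOn a r hr w hw i)
    have h2 := ContinuousOn.measurable_piecewise this
      (continuousOn_const (c := (0:ENNReal)) (s := (Ka a)ᶜ)) hKm
    rw [hf, ← Set.piecewise_eq_indicator]
    exact h2
  have hconj : Real.HolderConjugate (Fintype.card (Fin N) : ℝ) ((N : ℝ) / (N - 1)) := by
    rw [Fintype.card_fin, Real.holderConjugate_iff_eq_conjExponent (by linarith)]
  have main := lintegral_prod_lintegral_pow_le (fun _ : Fin N => (volume : Measure ℝ)) hconj hfm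
  rw [← volume_pi] at main
  have hright : ∫⁻ x, f x = ∫⁻ x in Ka a, ∑ i, ENNReal.ofReal (Fint a r w i x) :=
    lintegral_indicator hKm _
  rw [hright] at main
  refine le_trans ?_ main
  refine le_trans ?_ (setLIntegral_le_lintegral (Ka a) _)
  refine setLIntegral_mono' hKm fun x hx => ?_
  have hc : (0:ℝ) ≤ 1 / ((N:ℝ) - 1) := by
    apply div_nonneg <;> linarith
  have hline : ∀ i, ENNReal.ofReal (|w x| ^ r i) ≤ ∫⁻ t, f (Function.update x i t) := by
    intro i
    have hup : ∀ t ∈ Set.Ioo (-a i) (a i), Function.update x i t ∈ Ka a := by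
      intro t ht j
      by_cases hj : j = i
      · subst hj; simpa [abs_lt] using ht
      · simpa [hj] using hx j
    have h1 := oneD (a i) (r i) (ha i) (hr i) (fun t => w (Function.update x i t))
      (fun t => Dop i w (Function.update x i t)) ?_ ?_ (x i) ?_
    · simp only [Function.update_eq_self] at h1
      refine h1.trans ?_
      rw [← lintegral_indicator measurableSet_Ioo]
      refine lintegral_mono fun t => ?_
      by_cases ht : t ∈ Set.Ioo (-a i) (a i)
      · rw [Set.indicator_of_mem ht, hf, Set.indicator_of_mem (hup t ht)]
        exact Finset.single_le_sum (f := fun j => ENNReal.ofReal (Fint a r w j (Function.update x i t))) (fun _ _ => bot_le) (Finset.mem_univ i)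
      · rw [Set.indicator_of_notMem ht]; exact bot_le
    · intro t ht
      have hd : HasFDerivAt w (fderiv ℝ w (Function.update x i t)) (Function.update x i t) :=
        ((hw.differentiableOn one_ne_zero).differentiableAt
          ((Ka_isOpen a).mem_nhds (hup t ht))).hasFDerivAt
      exact hd.comp_hasDerivAt t (hasDerivAt_update x i t)
    · refine (Dop_continuousOn a w hw i).comp ?_ hup
      exact (Continuous.update (continuous_const (y := x)) i (continuous_id (X := ℝ))).continuousOn
    · have := hx i; rwa [abs_lt] at this
  calc ENNReal.ofReal (|w x| ^ q) = ∏ i, (ENNReal.ofReal (|w x| ^ r i)) ^ (1 / ((N:ℝ) - 1)) := by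
        have : ∀ i, (ENNReal.ofReal (|w x| ^ r i)) ^ (1 / ((N:ℝ) - 1)) =
            ENNReal.ofReal (|w x| ^ (r i * (1 / ((N:ℝ) - 1)))) := by
          intro i
          rw [ENNReal.ofReal_rpow_of_nonneg (by positivity) hc, ← Real.rpow_mul (abs_nonneg _)]
        simp_rw [this]
        rw [← ENNReal.ofReal_prod_of_nonneg (fun i _ => by positivity),
          ← Real.rpow_sum_of_nonneg (abs_nonneg _)
            (fun i _ => mul_nonneg (by linarith [hr i]) hc), ← Finset.sum_mul, hq]
        congr 2
        have : (N:ℝ) - 1 ≠ 0 := by linarith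
        field_simp
    _ ≤ _ := by
        rw [Fintype.card_fin]
        exact Finset.prod_le_prod' fun i _ => ENNReal.rpow_le_rpow (hline i) hc

instance Ka_finite {N : ℕ} (a : Fin N → ℝ) : IsFiniteMeasure (volume.restrict (Ka a)) := by
  constructor
  rw [Measure.restrict_apply_univ, Ka_eq]
  refine lt_of_le_of_lt (measure_mono (Set.pi_mono fun i _ => Set.Ioo_subset_Icc_self)) ?_
  rw [Set.pi_univ_Icc]
  exact isCompact_Icc.measure_lt_top

lemma memLp_Ka {N : ℕ} (a : Fin N → ℝ) (g : (Fin N → ℝ) → ℝ) (hc : ContinuousOn g (Ka a))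
    (M : ℝ) (hM : ∀ x ∈ Ka a, |g x| ≤ M) (e : ENNReal) : MemLp g e (volume.restrict (Ka a)) :=
  MemLp.of_bound (hc.aestronglyMeasurable (Ka_isOpen a).measurableSet) M
    ((ae_restrict_iff' (Ka_isOpen a).measurableSet).2 (Eventually.of_forall hM))

lemma int_Ka {N : ℕ} (a : Fin N → ℝ) (g : (Fin N → ℝ) → ℝ) (hc : ContinuousOn g (Ka a))
    (M : ℝ) (hM : ∀ x ∈ Ka a, |g x| ≤ M) : IntegrableOn g (Ka a) :=
  memLp_one_iff_integrable.1 (memLp_Ka a g hc M hM 1)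

lemma rpow_cont {N : ℕ} (a : Fin N → ℝ) (g : (Fin N → ℝ) → ℝ) (hc : ContinuousOn g (Ka a))
    (e : ℝ) (he : 0 ≤ e) : ContinuousOn (fun x => |g x| ^ e) (Ka a) :=
  hc.abs.rpow_const fun _ _ => Or.inr he

lemma rpow_bd {N : ℕ} (a : Fin N → ℝ) (g : (Fin N → ℝ) → ℝ)
    (M : ℝ) (hM : ∀ x ∈ Ka a, |g x| ≤ M) (e : ℝ) (he : 0 ≤ e) :
    ∀ x ∈ Ka a, |(|g x| ^ e)| ≤ M ^ e := by
  intro x hx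
  rw [abs_of_nonneg (by positivity)]
  exact Real.rpow_le_rpow (abs_nonneg _) (hM x hx) he

lemma young_aux (r q ε : ℝ) (hr : 1 < r) (hrq : r < q) (hε : 0 < ε) :
    ∃ C : ℝ, 0 < C ∧ ∀ t : ℝ, 0 ≤ t → t ^ r ≤ ε * t ^ q + C * t := by
  set T : ℝ := ε ^ (-1 / (q - r)) with hT
  have hTpos : 0 < T := Real.rpow_pos_of_pos hε _
  refine ⟨T ^ (r - 1), Real.rpow_pos_of_pos hTpos _, fun t ht => ?_⟩
  rcases eq_or_lt_of_le ht with h0 | h0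
  · rw [← h0, Real.zero_rpow (by linarith), Real.zero_rpow (by linarith)]; simp
  have h1 : 0 ≤ ε * t ^ q := by positivity
  have h2 : 0 ≤ T ^ (r - 1) * t := by positivity
  rcases le_total t T with h | h
  · have : t ^ (r - 1) ≤ T ^ (r - 1) := Real.rpow_le_rpow ht h (by linarith)
    have h3 : t ^ r = t ^ (r - 1) * t := by
      rw [← Real.rpow_add_one h0.ne']; congr 1; ring
    rw [h3]
    have := mul_le_mul_of_nonneg_right this ht
    linarith
  · have h4 : T ^ (q - r) ≤ t ^ (q - r) := Real.rpow_le_rpow hTpos.le h (by linarith)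
    have h5 : T ^ (q - r) = ε⁻¹ := by
      rw [hT, ← Real.rpow_mul hε.le, div_mul_cancel₀ _ (by linarith), Real.rpow_neg_one]
    have h6 : t ^ q = t ^ (q - r) * t ^ r := by
      rw [← Real.rpow_add h0]; congr 1; ring
    have h7 : 1 ≤ ε * t ^ (q - r) := by
      rw [h5] at h4
      calc 1 = ε * ε⁻¹ := by field_simp
        _ ≤ _ := by gcongr
    have h8 : 0 ≤ t ^ r := by positivity
    rw [h6]
    nlinarith

lemma holder_Ka {N : ℕ} (a : Fin N → ℝ) (f g : (Fin N → ℝ) → ℝ) (hf : ContinuousOn f (Ka a))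
    (hg : ContinuousOn g (Ka a)) (M : ℝ) (hfM : ∀ x ∈ Ka a, |f x| ≤ M) (hgM : ∀ x ∈ Ka a, |g x| ≤ M)
    (α β e e' : ℝ) (hα : 0 ≤ α) (hβ : 0 ≤ β) (h : e.HolderConjugate e') :
    ∫ x in Ka a, |f x| ^ α * |g x| ^ β ≤
      (∫ x in Ka a, |f x| ^ (α * e)) ^ (1 / e) * (∫ x in Ka a, |g x| ^ (β * e')) ^ (1 / e') := by
  have := integral_mul_le_Lp_mul_Lq_of_nonneg (μ := volume.restrict (Ka a)) h
    (f := fun x => |f x| ^ α) (g := fun x => |g x| ^ β)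
    (Eventually.of_forall fun x => by simp only [Pi.zero_apply]; positivity)
    (Eventually.of_forall fun x => by simp only [Pi.zero_apply]; positivity)
    (memLp_Ka a _ (rpow_cont a f hf α hα) (M ^ α) (rpow_bd a f M hfM α hα) _)
    (memLp_Ka a _ (rpow_cont a g hg β hβ) (M ^ β) (rpow_bd a g M hgM β hβ) _)
  simpa only [Real.rpow_mul (abs_nonneg _)] using this

lemma normalized (N : ℕ) (hN : 2 ≤ N) (a : Fin N → ℝ) (ha : ∀ i, 0 < a i)
    (p : Fin N → ℝ) (hp : ∀ i, 1 < p i) (q : ℝ) (hq : ∀ i, p i < q)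
    (hsum : ∑ i, (1 + q * (1 - (p i)⁻¹)) = (N - 1) * q) :
    ∃ C : ℝ, 0 < C ∧ ∀ (w : (Fin N → ℝ) → ℝ) (M : ℝ), ContDiffOn ℝ 1 w (Ka a) →
      (∀ x ∈ Ka a, |w x| ≤ M) → (∀ i, ∀ x ∈ Ka a, |Dop i w x| ≤ M) →
      ∫ x in Ka a, |w x| ^ q = 1 →
      1 ≤ C * (Lnorm 2 (Ka a) w + ∑ i, Lnorm (p i) (Ka a) (Dop i w)) := by
  have hN' : (2:ℝ) ≤ N := by exact_mod_cast hN
  have hKm := (Ka_isOpen a).measurableSet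
  have hp0 : ∀ i, 0 < p i := fun i => by linarith [hp i]
  have hq0 : 0 < q := (hp0 ⟨0, by omega⟩).trans (hq ⟨0, by omega⟩)
  set r : Fin N → ℝ := fun i => 1 + q * (1 - (p i)⁻¹) with hrdef
  have hr : ∀ i, 1 < r i := by
    intro i
    have : (p i)⁻¹ < 1 := inv_lt_one_of_one_lt₀ (hp i)
    have := mul_pos hq0 (by linarith : 0 < 1 - (p i)⁻¹)
    simp only [hrdef]; linarith
  have hrq : ∀ i, r i < q := by
    intro i
    have : 1 < q * (p i)⁻¹ := by
      rw [← div_eq_mul_inv, one_lt_div (hp0 i)]; exact hq i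
    simp only [hrdef]; linarith
  have hε : ∀ i, 0 < a i / N := fun i => div_pos (ha i) (by linarith)
  choose Cy hCy hy using fun i => young_aux (r i) q (a i / N) (hr i) (hrq i) (hε i)
  set V : ℝ := (∫ x in Ka a, (1:ℝ)) ^ (1 / (2:ℝ)) with hV
  have hV0 : 0 ≤ V := Real.rpow_nonneg (integral_nonneg fun x => zero_le_one) _
  set S1 := ∑ i, Cy i / (2 * a i) * V with hS1
  set S2 := ∑ i, r i with hS2
  have hS1n : 0 ≤ S1 := Finset.sum_nonneg fun i _ =>
    mul_nonneg (div_nonneg (hCy i).le (by linarith [ha i])) hV0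
  have hS2n : 0 ≤ S2 := Finset.sum_nonneg fun i _ => by linarith [hr i]
  refine ⟨2 * (S1 + S2) + 1, by positivity, ?_⟩
  intro w M hw hwM hDM hnorm
  have hwc := hw.continuousOn
  have hDc := Dop_continuousOn a w hw
  have hM0 : 0 ≤ M := by
    have : (0 : Fin N → ℝ) ∈ Ka a := fun i => by simpa using ha i
    exact (abs_nonneg _).trans (hwM 0 this)
  have hF0 : ∀ i x, 0 ≤ Fint a r w i x := by
    intro i x
    have := ha i
    have := hr i
    unfold Fint; positivity
  have hi1 : ∀ i, IntegrableOn (fun x => |w x| ^ r i) (Ka a) := fun i =>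
    int_Ka a _ (rpow_cont a w hwc _ (by linarith [hr i])) _ (rpow_bd a w M hwM _ (by linarith [hr i]))
  have hiq : IntegrableOn (fun x => |w x| ^ q) (Ka a) :=
    int_Ka a _ (rpow_cont a w hwc _ hq0.le) _ (rpow_bd a w M hwM _ hq0.le)
  have hiw : IntegrableOn (fun x => |w x|) (Ka a) :=
    int_Ka a _ hwc.abs M (fun x hx => by rw [abs_abs]; exact hwM x hx)
  have hi2 : ∀ i, IntegrableOn (fun x => |w x| ^ (r i - 1) * |Dop i w x|) (Ka a) := fun i => by
    refine int_Ka a _ ((rpow_cont a w hwc _ (by linarith [hr i])).mul (hDc i).abs)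
      (M ^ (r i - 1) * M) ?_
    intro x hx
    rw [abs_mul, abs_abs]
    exact mul_le_mul (rpow_bd a w M hwM _ (by linarith [hr i]) x hx) (hDM i x hx) (abs_nonneg _)
      (by positivity)
  have hFeq : ∀ i, Fint a r w i = fun x => (2 * a i)⁻¹ * |w x| ^ r i +
      r i * (|w x| ^ (r i - 1) * |Dop i w x|) := by
    intro i; funext x; unfold Fint; ring
  have hFint : ∀ i, IntegrableOn (Fint a r w i) (Ka a) := by
    intro i
    rw [hFeq]
    exact ((hi1 i).const_mul _).add ((hi2 i).const_mul _)
  have hFval : ∀ i, ∫ x in Ka a, Fint a r w i x = (2 * a i)⁻¹ * (∫ x in Ka a, |w x| ^ r i) +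
      r i * ∫ x in Ka a, |w x| ^ (r i - 1) * |Dop i w x| := by
    intro i
    rw [hFeq, integral_add ((hi1 i).const_mul _) ((hi2 i).const_mul _), integral_const_mul,
      integral_const_mul]
  have hone : 1 ≤ ∑ i, ∫ x in Ka a, Fint a r w i x := by
    have hg := gridlines N hN a ha r hr q hsum w hw
    rw [← ofReal_integral_eq_lintegral_ofReal hiq (Eventually.of_forall fun x => by
      simp only [Pi.zero_apply]; positivity), hnorm, ENNReal.ofReal_one] at hg
    have hexp : 0 < (N:ℝ) / (N - 1) := div_pos (by linarith) (by linarith)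
    have h1 : 1 ≤ ∫⁻ x in Ka a, ∑ i, ENNReal.ofReal (Fint a r w i x) := by
      by_contra hlt
      push Not at hlt
      exact absurd hg (not_le.2 (ENNReal.rpow_lt_one hlt hexp))
    rw [lintegral_finsetSum' _ (fun i _ =>
      ((Fint_continuousOn a r hr w hw i).aemeasurable hKm).ennreal_ofReal)] at h1
    have h2 : ∀ i, ∫⁻ x in Ka a, ENNReal.ofReal (Fint a r w i x) =
        ENNReal.ofReal (∫ x in Ka a, Fint a r w i x) := fun i =>
      (ofReal_integral_eq_lintegral_ofReal (hFint i) (Eventually.of_forall (hF0 i))).symm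
    simp_rw [h2] at h1
    rw [← ENNReal.ofReal_sum_of_nonneg (fun i _ => integral_nonneg (hF0 i))] at h1
    rwa [ENNReal.one_le_ofReal] at h1
  have hL1 : ∫ x in Ka a, |w x| ≤ V * Lnorm 2 (Ka a) w := by
    have := holder_Ka a (fun _ => (1:ℝ)) w continuousOn_const hwc (max 1 M)
      (fun x _ => by simp) (fun x hx => (hwM x hx).trans (le_max_right _ _)) 1 1 2 2
      zero_le_one zero_le_one Real.HolderConjugate.two_two
    simpa [Lnorm, hV] using this
  have hL2 : ∀ i, ∫ x in Ka a, |w x| ^ r i ≤ a i / N + Cy i * (V * Lnorm 2 (Ka a) w) := by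
    intro i
    calc ∫ x in Ka a, |w x| ^ r i ≤ ∫ x in Ka a, (a i / N * |w x| ^ q + Cy i * |w x|) :=
          integral_mono (hi1 i) ((hiq.const_mul _).add (hiw.const_mul _))
            (fun x => hy i _ (abs_nonneg _))
      _ = a i / N + Cy i * ∫ x in Ka a, |w x| := by
          rw [integral_add (hiq.const_mul _) (hiw.const_mul _), integral_const_mul,
            integral_const_mul, hnorm, mul_one]
      _ ≤ _ := by gcongr; exact (hCy i).le
  have hL3 : ∀ i, ∫ x in Ka a, |w x| ^ (r i - 1) * |Dop i w x| ≤ Lnorm (p i) (Ka a) (Dop i w) := by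
    intro i
    have hc := (Real.HolderConjugate.conjExponent (hp i)).symm
    have := holder_Ka a w (Dop i w) hwc (hDc i) M hwM (hDM i) (r i - 1) 1 _ _
      (by linarith [hr i]) zero_le_one hc
    have he : (r i - 1) * (p i).conjExponent = q := by
      have h1 := hp i
      have h2 : p i - 1 ≠ 0 := by linarith
      have h3 := (hp0 i).ne'
      simp only [hrdef, Real.conjExponent]
      field_simp
      ring
    rw [he, hnorm, Real.one_rpow, one_mul, one_mul] at this
    simpa [Lnorm] using this
  have hLn : 0 ≤ Lnorm 2 (Ka a) w :=
    Real.rpow_nonneg (integral_nonneg fun x => by positivity) _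
  have hLD : ∀ i, 0 ≤ Lnorm (p i) (Ka a) (Dop i w) := fun i =>
    Real.rpow_nonneg (integral_nonneg fun x => by positivity) _
  set L := Lnorm 2 (Ka a) w
  set D := fun i => Lnorm (p i) (Ka a) (Dop i w) with hD
  have hDs : ∀ i, D i ≤ ∑ j, D j := fun i =>
    Finset.single_le_sum (fun j _ => hLD j) (Finset.mem_univ i)
  have hterm : ∀ i, ∫ x in Ka a, Fint a r w i x ≤
      1 / (2 * N) + Cy i / (2 * a i) * V * L + r i * ∑ j, D j := by
    intro i
    have hai := ha i
    have hri := hr i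
    rw [hFval]
    calc _ ≤ (2 * a i)⁻¹ * (a i / N + Cy i * (V * L)) + r i * ∑ j, D j := by
          gcongr
          · exact hL2 i
          · exact (hL3 i).trans (hDs i)
      _ = _ := by field_simp
  have htot : 1 ≤ 1 / 2 + S1 * L + S2 * ∑ j, D j := by
    refine hone.trans ((Finset.sum_le_sum fun i _ => hterm i).trans (le_of_eq ?_))
    rw [Finset.sum_add_distrib, Finset.sum_add_distrib, hS1, hS2, Finset.sum_mul, Finset.sum_mul]
    simp only [Finset.sum_const, Finset.card_univ, Fintype.card_fin, nsmul_eq_mul]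
    have : (N:ℝ) ≠ 0 := by linarith
    congr 2
    field_simp
  have hDn : 0 ≤ ∑ j, D j := Finset.sum_nonneg fun j _ => hLD j
  have e1 := mul_nonneg hS1n hDn
  have e2 := mul_nonneg hS2n hLn
  show 1 ≤ (2 * (S1 + S2) + 1) * (L + ∑ j, D j)
  nlinarith

lemma Lnorm_nonneg {N : ℕ} (e : ℝ) (Ω : Set (Fin N → ℝ)) (v : (Fin N → ℝ) → ℝ) :
    0 ≤ Lnorm e Ω v :=
  Real.rpow_nonneg (integral_nonneg fun x => by positivity) _

lemma Lnorm_const_mul {N : ℕ} (e : ℝ) (he : 0 < e) (Ω : Set (Fin N → ℝ)) (v : (Fin N → ℝ) → ℝ)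
    (c : ℝ) (hc : 0 ≤ c) : Lnorm e Ω (fun x => c * v x) = c * Lnorm e Ω v := by
  unfold Lnorm
  have : ∀ x, |c * v x| ^ e = c ^ e * |v x| ^ e := fun x => by
    rw [abs_mul, abs_of_nonneg hc, Real.mul_rpow hc (abs_nonneg _)]
  simp_rw [this]
  rw [integral_const_mul, Real.mul_rpow (by positivity) (integral_nonneg fun x => by positivity),
    ← Real.rpow_mul hc, mul_one_div_cancel he.ne', Real.rpow_one]

lemma Dop_const_mul {N : ℕ} (i : Fin N) (v : (Fin N → ℝ) → ℝ) (c : ℝ) :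
    Dop i (fun x => c * v x) = fun x => c * Dop i v x := by
  funext x
  have : (fun x => c * v x) = c • v := by funext y; simp
  unfold Dop
  rw [this, fderiv_const_smul_field]
  simp

lemma sobolev_Ka (N : ℕ) (hN : 2 ≤ N) (a : Fin N → ℝ) (ha : ∀ i, 0 < a i)
    (p : Fin N → ℝ) (hp : ∀ i, 1 < p i) (q : ℝ) (hq : ∀ i, p i < q)
    (hsum : ∑ i, (1 + q * (1 - (p i)⁻¹)) = (N - 1) * q) :
    ∃ C : ℝ, 0 < C ∧ ∀ (u : (Fin N → ℝ) → ℝ) (M : ℝ), ContDiffOn ℝ 1 u (Ka a) →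
      (∀ x ∈ Ka a, |u x| ≤ M) → (∀ i, ∀ x ∈ Ka a, |Dop i u x| ≤ M) →
      Lnorm q (Ka a) u ≤ C * (Lnorm 2 (Ka a) u + ∑ i, Lnorm (p i) (Ka a) (Dop i u)) := by
  obtain ⟨C, hC, h⟩ := normalized N hN a ha p hp q hq hsum
  refine ⟨C, hC, fun u M hu huM hDM => ?_⟩
  have hp0 : ∀ i, 0 < p i := fun i => by linarith [hp i]
  have hq0 : 0 < q := (hp0 ⟨0, by omega⟩).trans (hq ⟨0, by omega⟩)
  rcases eq_or_lt_of_le (Lnorm_nonneg q (Ka a) u) with h0 | h0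
  · rw [← h0]
    exact mul_nonneg hC.le (add_nonneg (Lnorm_nonneg _ _ _)
      (Finset.sum_nonneg fun i _ => Lnorm_nonneg _ _ _))
  set A := Lnorm q (Ka a) u with hA
  have hAi : 0 ≤ A⁻¹ := by positivity
  have hn : Lnorm q (Ka a) (fun x => A⁻¹ * u x) = 1 := by
    rw [Lnorm_const_mul q hq0 _ _ _ hAi, ← hA, inv_mul_cancel₀ h0.ne']
  have hn1 : ∫ x in Ka a, |A⁻¹ * u x| ^ q = 1 := by
    have hnn : 0 ≤ ∫ x in Ka a, |A⁻¹ * u x| ^ q := integral_nonneg fun x => by positivity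
    unfold Lnorm at hn
    have := congrArg (fun z => z ^ q) hn
    simp only [Real.one_rpow] at this
    rwa [← Real.rpow_mul hnn, one_div_mul_cancel hq0.ne', Real.rpow_one] at this
  have := h (fun x => A⁻¹ * u x) (A⁻¹ * M) (contDiffOn_const.mul hu) ?_ ?_ hn1
  · simp_rw [Dop_const_mul] at this
    rw [Lnorm_const_mul 2 two_pos _ _ _ hAi] at this
    simp_rw [fun i => Lnorm_const_mul (p i) (hp0 i) (Ka a) (Dop i u) A⁻¹ hAi] at this
    rw [← Finset.mul_sum, ← mul_add, mul_left_comm, inv_mul_eq_div, one_le_div h0] at this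
    exact this
  · intro x hx
    rw [abs_mul, abs_of_nonneg hAi]
    exact mul_le_mul_of_nonneg_left (huM x hx) hAi
  · intro i x hx
    rw [Dop_const_mul, abs_mul, abs_of_nonneg hAi]
    exact mul_le_mul_of_nonneg_left (hDM i x hx) hAi

lemma interp_Ka {N : ℕ} (a : Fin N → ℝ) (u : (Fin N → ℝ) → ℝ) (hu : ContinuousOn u (Ka a))
    (M : ℝ) (hM : ∀ x ∈ Ka a, |u x| ≤ M) (s q θ : ℝ) (hs : 0 < s) (hq : 0 < q)
    (h0 : 0 < θ) (h1 : θ < 1) (hθ : 1 / s = (1 - θ) / 2 + θ / q) :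
    Lnorm s (Ka a) u ≤ Lnorm 2 (Ka a) u ^ (1 - θ) * Lnorm q (Ka a) u ^ θ := by
  have hθ1 : 0 < 1 - θ := by linarith
  have hsum : (1 - θ) * s / 2 + θ * s / q = 1 := by
    have := congrArg (fun z => z * s) hθ
    simp only [one_div_mul_cancel hs.ne'] at this
    exact Eq.trans (by ring) this.symm
  have hc := Real.HolderConjugate.inv_inv (a := (1 - θ) * s / 2) (b := θ * s / q)
    (by positivity) (by positivity) hsum
  have := holder_Ka a u u hu hu M hM hM ((1 - θ) * s) (θ * s) _ _ (by positivity) (by positivity) hc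
  have e1 : (1 - θ) * s * ((1 - θ) * s / 2)⁻¹ = 2 := by field_simp
  have e2 : θ * s * (θ * s / q)⁻¹ = q := by field_simp
  have e3 : ∀ x, |u x| ^ ((1 - θ) * s) * |u x| ^ (θ * s) = |u x| ^ s := fun x => by
    rw [← Real.rpow_add_of_nonneg (abs_nonneg _) (by positivity) (by positivity)]
    congr 1; ring
  rw [e1, e2] at this
  simp_rw [e3] at this
  have n2 : 0 ≤ ∫ x in Ka a, |u x| ^ (2:ℝ) := integral_nonneg fun x => by positivity
  have nq : 0 ≤ ∫ x in Ka a, |u x| ^ q := integral_nonneg fun x => by positivity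
  have ns : 0 ≤ ∫ x in Ka a, |u x| ^ s := integral_nonneg fun x => by positivity
  unfold Lnorm
  refine (Real.rpow_le_rpow ns this (by positivity)).trans (le_of_eq ?_)
  rw [Real.mul_rpow (by positivity) (by positivity), ← Real.rpow_mul n2, ← Real.rpow_mul nq,
    ← Real.rpow_mul n2, ← Real.rpow_mul nq]
  congr 2 <;> field_simp

lemma bounds_Ka {N : ℕ} (a : Fin N → ℝ) (ha : ∀ i, 0 < a i) (u : (Fin N → ℝ) → ℝ)
    (hu : ContDiffOn ℝ 1 u (closure (Ka a))) :
    ∃ M, (∀ x ∈ Ka a, |u x| ≤ M) ∧ (∀ i, ∀ x ∈ Ka a, |Dop i u x| ≤ M) := by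
  have hcomp : IsCompact (closure (Ka a)) := by
    rw [Ka_eq, closure_pi_set]
    exact isCompact_univ_pi fun i => by
      rw [closure_Ioo (by linarith [ha i])]; exact isCompact_Icc
  have hconv : Convex ℝ (Ka a) := by
    rw [Ka_eq]; exact convex_pi fun i _ => convex_Ioo _ _
  have h0 : (0 : Fin N → ℝ) ∈ Ka a := fun i => by simpa using ha i
  have huniq : UniqueDiffOn ℝ (closure (Ka a)) := by
    refine uniqueDiffOn_convex hconv.closure ⟨0, ?_⟩
    exact mem_interior_iff_mem_nhds.2 (mem_of_superset ((Ka_isOpen a).mem_nhds h0) subset_closure)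
  obtain ⟨M1, hM1⟩ := hcomp.exists_bound_of_continuousOn hu.continuousOn
  obtain ⟨M2, hM2⟩ := hcomp.exists_bound_of_continuousOn
    (hu.continuousOn_fderivWithin huniq le_rfl)
  refine ⟨max M1 M2, fun x hx => (hM1 x (subset_closure hx)).trans (le_max_left _ _), ?_⟩
  intro i x hx
  refine le_trans ?_ (le_max_right _ _)
  have h2 := hM2 x (subset_closure hx)
  rw [fderivWithin_of_mem_nhds (mem_of_superset ((Ka_isOpen a).mem_nhds hx) subset_closure)] at h2
  have h3 := (fderiv ℝ u x).le_opNorm (Pi.single i 1)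
  rw [Pi.norm_single, norm_one, mul_one] at h3
  exact h3.trans h2

theorem stmt8 (N : ℕ) (hN : 2 ≤ N) (a : Fin N → ℝ) (ha : ∀ i, 0 < a i)
    (p : Fin N → ℝ) (hp : ∀ i, 2 * N / (N + 2) < p i)
    (ph phs : ℝ) (hph : ph = N / ∑ i, (p i)⁻¹) (hphN : ph < N)
    (hphs : phs = N * ph / (N - ph)) (hpv : ∀ i, p i < phs)
    (s : ℝ) (hs2 : 2 < s) (hs : s < phs)
    (θ : ℝ) (hθ : θ = (1 / 2 - 1 / s) / ((N + 2) / (2 * N) - 1 / ph)) :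
    ∀ M₀ : ℝ, 0 < M₀ →
      ∃ C C' : ℝ, 0 < C ∧ 0 < C' ∧
        ∀ u : (Fin N → ℝ) → ℝ, ContDiffOn ℝ 1 u (closure (Ka a)) →
          Lnorm 2 (Ka a) u ≤ M₀ →
          Lnorm s (Ka a) u ≤
            C * (∑ i, Lnorm (p i) (Ka a) (Dop i u) ^ θ) + C' := by

  have hN' : (2:ℝ) ≤ N := by exact_mod_cast hN
  have hN0 : (0:ℝ) < N := by linarith
  have hp1 : ∀ i, 1 < p i := by
    intro i
    refine lt_of_le_of_lt ?_ (hp i)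
    rw [le_div_iff₀ (by linarith)]; linarith
  have hp0 : ∀ i, 0 < p i := fun i => by linarith [hp1 i]
  set σ := ∑ i, (p i)⁻¹ with hσ
  have hne : (Finset.univ : Finset (Fin N)).Nonempty := ⟨⟨0, by omega⟩, Finset.mem_univ _⟩
  have hσ0 : 0 < σ := Finset.sum_pos (fun i _ => inv_pos.2 (hp0 i)) hne
  have hph0 : 0 < ph := by rw [hph]; positivity
  have hσ1 : 1 < σ := by
    rw [hph, div_lt_iff₀ hσ0] at hphN
    by_contra hcon
    push Not at hcon
    nlinarith
  have hσ2 : σ < (N + 2) / 2 := by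
    have : σ < ∑ i : Fin N, ((N:ℝ) + 2) / (2 * N) := by
      refine Finset.sum_lt_sum_of_nonempty hne fun i _ => ?_
      have h1 := hp i
      rw [inv_lt_comm₀ (hp0 i) (by positivity), inv_div]
      exact h1
    rw [Finset.sum_const, Finset.card_univ, Fintype.card_fin, nsmul_eq_mul] at this
    refine this.trans_eq ?_
    field_simp
  have hphs' : phs = N / (σ - 1) := by
    have h1 : σ - 1 ≠ 0 := by linarith
    have h2 : (N:ℝ) - N / σ ≠ 0 := by
      have : N - N / σ = N * (σ - 1) / σ := by field_simp
      rw [this]; positivity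
    rw [hphs, hph]
    field_simp
  have hq0 : 0 < phs := by rw [hphs']; exact div_pos hN0 (by linarith)
  have hsum : ∑ i, (1 + phs * (1 - (p i)⁻¹)) = (N - 1) * phs := by
    rw [Finset.sum_add_distrib, ← Finset.mul_sum, Finset.sum_sub_distrib]
    simp only [Finset.sum_const, Finset.card_univ, Fintype.card_fin, nsmul_eq_mul, mul_one]
    rw [← hσ]
    have h1 : phs * (σ - 1) = N := by rw [hphs']; exact div_mul_cancel₀ _ (by linarith)
    linarith
  have hden : ((N:ℝ) + 2) / (2 * N) - 1 / ph = 1 / 2 - 1 / phs := by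
    rw [hphs', hph]; field_simp; ring
  rw [hden] at hθ
  have hs0 : 0 < s := by linarith
  have i1 : 1 / s < 1 / 2 := one_div_lt_one_div_of_lt two_pos hs2
  have i2 : 1 / phs < 1 / s := one_div_lt_one_div_of_lt hs0 hs
  have hθ0 : 0 < θ := by rw [hθ]; apply div_pos <;> linarith
  have hθ1 : θ < 1 := by rw [hθ, div_lt_one (by linarith)]; linarith
  have hθeq : 1 / s = (1 - θ) / 2 + θ / phs := by
    have : θ * (1 / 2 - 1 / phs) = 1 / 2 - 1 / s := by
      rw [hθ]; exact div_mul_cancel₀ _ (by linarith)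
    rw [div_eq_mul_one_div θ phs]
    linarith
  obtain ⟨C, hC, hS⟩ := sobolev_Ka N hN a ha p hp1 phs hpv hsum
  intro M₀ hM₀
  have hCθ : 0 < M₀ ^ (1 - θ) * C ^ θ := by positivity
  refine ⟨M₀ ^ (1 - θ) * C ^ θ, M₀ ^ (1 - θ) * C ^ θ * M₀ ^ θ, hCθ, by positivity, ?_⟩
  intro u hu hu2
  obtain ⟨M, hM, hDM⟩ := bounds_Ka a ha u hu
  have hu' := hu.mono (subset_closure (s := Ka a))
  have hsob := hS u M hu' hM hDM
  have hint := interp_Ka a u hu'.continuousOn M hM s phs θ hs0 hq0 hθ0 hθ1 hθeq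
  have hDn : ∀ i, 0 ≤ Lnorm (p i) (Ka a) (Dop i u) := fun i => Lnorm_nonneg _ _ _
  have hDs : 0 ≤ ∑ i, Lnorm (p i) (Ka a) (Dop i u) := Finset.sum_nonneg fun i _ => hDn i
  have h2n := Lnorm_nonneg 2 (Ka a) u
  have hqn := Lnorm_nonneg phs (Ka a) u
  have hsub : ∀ t : Finset (Fin N), (∑ i ∈ t, Lnorm (p i) (Ka a) (Dop i u)) ^ θ ≤
      ∑ i ∈ t, Lnorm (p i) (Ka a) (Dop i u) ^ θ := by
    intro t
    induction t using Finset.induction_on with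
    | empty => simp [Real.zero_rpow hθ0.ne']
    | insert i t hi ih =>
      rw [Finset.sum_insert hi, Finset.sum_insert hi]
      exact (Real.rpow_add_le_add_rpow (hDn i) (Finset.sum_nonneg fun j _ => hDn j)
        hθ0.le hθ1.le).trans (by gcongr)
  calc Lnorm s (Ka a) u ≤ Lnorm 2 (Ka a) u ^ (1 - θ) * Lnorm phs (Ka a) u ^ θ := hint
    _ ≤ M₀ ^ (1 - θ) * (C * (M₀ + ∑ i, Lnorm (p i) (Ka a) (Dop i u))) ^ θ := by
        have hq' : Lnorm phs (Ka a) u ≤ C * (M₀ + ∑ i, Lnorm (p i) (Ka a) (Dop i u)) :=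
          hsob.trans (by gcongr)
        exact mul_le_mul (Real.rpow_le_rpow h2n hu2 (by linarith))
          (Real.rpow_le_rpow hqn hq' hθ0.le) (by positivity) (by positivity)
    _ = M₀ ^ (1 - θ) * C ^ θ * (M₀ + ∑ i, Lnorm (p i) (Ka a) (Dop i u)) ^ θ := by
        rw [Real.mul_rpow hC.le (by positivity), mul_assoc]
    _ ≤ M₀ ^ (1 - θ) * C ^ θ * (M₀ ^ θ + ∑ i, Lnorm (p i) (Ka a) (Dop i u) ^ θ) := by
        gcongr
        exact (Real.rpow_add_le_add_rpow hM₀.le hDs hθ0.le hθ1.le).trans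
          (by gcongr; exact hsub _)
    _ = _ := by ring
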